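/- Let (A, L) be a random financial network with E[|L|₁] < ∞ and let b > 0. Then the systemic risk measure satisfies 0 ≤ ρ_b(A, L) < +∞; in particular there exists an allocation Y ∈ 𝒞 (indeed a constant one) with η(Λ(A+Y, L)) ≤ b. -/

import Mathlib

open MeasureTheory

/-- Total liability vector: `ℓ̄_i = ∑_j ℓ_{ij}`. -/
noncomputable def lbar {N : ℕ} (ℓ : Fin N → Fin N → ℝ) : Fin N → ℝ := fun i => ∑ j, ℓ i j

/-- Relative liability matrix: `π_{ij} = ℓ_{ij}/ℓ̄_i` if `ℓ̄_i > 0`, else `0`. -/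
noncomputable def relPi {N : ℕ} (ℓ : Fin N → Fin N → ℝ) : Fin N → Fin N → ℝ :=
  fun i j => if 0 < lbar ℓ i then ℓ i j / lbar ℓ i else 0

/-- The Eisenberg–Noe clearing map `Φ(p, a, π, ℓ̄) = (πᵀp + a) ∧ ℓ̄`. -/
noncomputable def Phi {N : ℕ} (π : Fin N → Fin N → ℝ) (a lb p : Fin N → ℝ) : Fin N → ℝ :=
  fun i => min ((∑ j, π j i * p j) + a i) (lb i)

/-- The clearing vector `CV(a, ℓ)`: the (for `a ∈ ℝ^N_{++}` unique) nonnegative fixed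
point of the clearing map associated with the liability matrix `ℓ`. -/
noncomputable def clearingVec {N : ℕ} (a : Fin N → ℝ) (ℓ : Fin N → Fin N → ℝ) : Fin N → ℝ :=
  Classical.epsilon fun p => (∀ i, 0 ≤ p i) ∧ Phi (relPi ℓ) a (lbar ℓ) p = p

/-- The Eisenberg–Noe aggregation function `Λ(a, ℓ) = ∑_i (ℓ̄_i − CV_i(a, ℓ))`. -/
noncomputable def aggLoss {N : ℕ} (a : Fin N → ℝ) (ℓ : Fin N → Fin N → ℝ) : ℝ :=
  ∑ i, (lbar ℓ i - clearingVec a ℓ i)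

/-- The feasible total bailout-capital levels: constants `c` such that some admissible
random allocation `Y ∈ 𝒞` with `∑ᵢ Yᵢ = c` a.s. makes the system acceptable. -/
noncomputable def feas {Ω : Type*} [MeasurableSpace Ω] (P : Measure Ω) {N : ℕ}
    (η : (Ω → ℝ) → ℝ) (A : Ω → Fin N → ℝ) (L : Ω → Fin N → Fin N → ℝ) (b : ℝ) : Set ℝ :=
  {c : ℝ | ∃ Y : Ω → Fin N → ℝ, Measurable Y ∧ (∀ ω i, 0 ≤ Y ω i) ∧
    (∀ᵐ ω ∂P, ∑ i, Y ω i = c) ∧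
    η (fun ω => aggLoss (fun i => A ω i + Y ω i) (L ω)) ≤ b}

/-- The systemic risk measure `ρ_b(A, L)`. -/
noncomputable def sysRisk {Ω : Type*} [MeasurableSpace Ω] (P : Measure Ω) {N : ℕ}
    (η : (Ω → ℝ) → ℝ) (A : Ω → Fin N → ℝ) (L : Ω → Fin N → Fin N → ℝ) (b : ℝ) : ℝ :=
  sInf (feas P η A L b)

theorem lbar_nonneg {N : ℕ} {ℓ : Fin N → Fin N → ℝ} (hℓ : ∀ i j, 0 ≤ ℓ i j) (i : Fin N) :
    0 ≤ lbar ℓ i :=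
  Finset.sum_nonneg fun j _ => hℓ i j

theorem relPi_nonneg {N : ℕ} {ℓ : Fin N → Fin N → ℝ} (hℓ : ∀ i j, 0 ≤ ℓ i j) (i j : Fin N) :
    0 ≤ relPi ℓ i j := by
  unfold relPi
  split_ifs with h
  · exact div_nonneg (hℓ i j) h.le
  · exact le_rfl

theorem Phi_mono {N : ℕ} {π : Fin N → Fin N → ℝ} (hπ : ∀ i j, 0 ≤ π i j) (a lb : Fin N → ℝ) :
    Monotone (Phi π a lb) := by
  intro p q hpq i
  unfold Phi
  gcongr with j _
  · exact hπ j i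
  · exact hpq j

theorem Phi_nonneg {N : ℕ} {π : Fin N → Fin N → ℝ} (hπ : ∀ i j, 0 ≤ π i j) {a lb p : Fin N → ℝ}
    (ha : ∀ i, 0 ≤ a i) (hlb : ∀ i, 0 ≤ lb i) (hp : ∀ i, 0 ≤ p i) (i : Fin N) :
    0 ≤ Phi π a lb p i :=
  le_min (add_nonneg (Finset.sum_nonneg fun j _ => mul_nonneg (hπ j i) (hp j)) (ha i)) (hlb i)

theorem continuous_Phi {N : ℕ} (π : Fin N → Fin N → ℝ) (a lb : Fin N → ℝ) :
    Continuous (Phi π a lb) := by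
  unfold Phi
  fun_prop

/-- Any nonnegative fixed point of the clearing map is below any other one, because for `a > 0`
the map is strictly subhomogeneous. -/
theorem Phi_fixedPoint_le {N : ℕ} {π : Fin N → Fin N → ℝ} (hπ : ∀ i j, 0 ≤ π i j)
    {a lb p q : Fin N → ℝ} (ha : ∀ i, 0 < a i) (hp0 : ∀ i, 0 ≤ p i) (hq0 : ∀ i, 0 ≤ q i)
    (hp : Phi π a lb p = p) (hq : Phi π a lb q = q) : p ≤ q := by
  by_contra hnot
  obtain ⟨k, hk⟩ : ∃ k, q k < p k := by simpa [Pi.le_def] using hnot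
  obtain ⟨i, hi, hmin⟩ := (Finset.univ.filter fun i => 0 < p i).exists_min_image
    (fun i => q i / p i) ⟨k, by simpa using (hq0 k).trans_lt hk⟩
  have hpi : 0 < p i := by simpa using hi
  set t := q i / p i with ht
  have ht0 : 0 ≤ t := div_nonneg (hq0 i) hpi.le
  have ht1 : t < 1 :=
    (hmin k (by simpa using (hq0 k).trans_lt hk)).trans_lt
      ((div_lt_one ((hq0 k).trans_lt hk)).2 hk)
  have htq : t * p i = q i := div_mul_cancel₀ _ hpi.ne'
  have hle : ∀ j, t * p j ≤ q j := by
    intro j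
    rcases (hp0 j).eq_or_lt with h | h
    · simpa [← h] using hq0 j
    · exact (le_div_iff₀ h).1 (hmin j (by simpa using h))
  have hpi' : min ((∑ j, π j i * p j) + a i) (lb i) = p i := congrFun hp i
  have hqi' : min ((∑ j, π j i * q j) + a i) (lb i) = q i := congrFun hq i
  have hsum : t * ∑ j, π j i * p j ≤ ∑ j, π j i * q j := by
    rw [Finset.mul_sum]
    refine Finset.sum_le_sum fun j _ => ?_
    rw [mul_left_comm]
    exact mul_le_mul_of_nonneg_left (hle j) (hπ j i)
  have hp1 : p i ≤ (∑ j, π j i * p j) + a i := hpi' ▸ min_le_left _ _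
  have hp2 : p i ≤ lb i := hpi' ▸ min_le_right _ _
  have h1 := mul_le_mul_of_nonneg_left hp1 ht0
  have h2 := mul_lt_mul_of_pos_right ht1 (ha i)
  have h3 := mul_lt_mul_of_pos_right ht1 hpi
  rcases min_choice ((∑ j, π j i * q j) + a i) (lb i) with h | h <;> rw [h] at hqi' <;> linarith

/-- The iterates of the clearing map started at the total liabilities. -/
noncomputable def clearingIter {N : ℕ} (a : Fin N → ℝ) (ℓ : Fin N → Fin N → ℝ) :
    ℕ → Fin N → ℝ
  | 0 => lbar ℓ
  | n + 1 => Phi (relPi ℓ) a (lbar ℓ) (clearingIter a ℓ n)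

theorem clearingIter_nonneg {N : ℕ} {a : Fin N → ℝ} {ℓ : Fin N → Fin N → ℝ}
    (ha : ∀ i, 0 < a i) (hℓ : ∀ i j, 0 ≤ ℓ i j) (n : ℕ) : ∀ i, 0 ≤ clearingIter a ℓ n i := by
  induction n with
  | zero => exact lbar_nonneg hℓ
  | succ n ih => exact Phi_nonneg (relPi_nonneg hℓ) (fun i => (ha i).le) (lbar_nonneg hℓ) ih

theorem antitone_clearingIter {N : ℕ} (a : Fin N → ℝ) {ℓ : Fin N → Fin N → ℝ}
    (hℓ : ∀ i j, 0 ≤ ℓ i j) : Antitone (clearingIter a ℓ) := by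
  refine antitone_nat_of_succ_le fun n => ?_
  induction n with
  | zero => exact fun i => min_le_right _ _
  | succ n ih => exact Phi_mono (relPi_nonneg hℓ) _ _ ih

theorem exists_tendsto_clearingIter {N : ℕ} {a : Fin N → ℝ} {ℓ : Fin N → Fin N → ℝ}
    (ha : ∀ i, 0 < a i) (hℓ : ∀ i j, 0 ≤ ℓ i j) :
    ∃ p : Fin N → ℝ, (∀ i, 0 ≤ p i) ∧ Phi (relPi ℓ) a (lbar ℓ) p = p ∧
      Filter.Tendsto (clearingIter a ℓ) Filter.atTop (nhds p) := by
  have hlim : Filter.Tendsto (clearingIter a ℓ) Filter.atTop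
      (nhds fun i => ⨅ n, clearingIter a ℓ n i) :=
    tendsto_pi_nhds.2 fun i => tendsto_atTop_ciInf
      (fun m n h => antitone_clearingIter a hℓ h i)
      ⟨0, Set.forall_mem_range.2 fun n => clearingIter_nonneg ha hℓ n i⟩
  refine ⟨_, fun i => le_ciInf fun n => clearingIter_nonneg ha hℓ n i, ?_, hlim⟩
  exact tendsto_nhds_unique (((continuous_Phi _ _ _).tendsto _).comp hlim)
    (hlim.comp (Filter.tendsto_add_atTop_nat 1))

theorem clearingVec_spec {N : ℕ} {a : Fin N → ℝ} {ℓ : Fin N → Fin N → ℝ}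
    (ha : ∀ i, 0 < a i) (hℓ : ∀ i j, 0 ≤ ℓ i j) :
    (∀ i, 0 ≤ clearingVec a ℓ i) ∧
      Phi (relPi ℓ) a (lbar ℓ) (clearingVec a ℓ) = clearingVec a ℓ := by
  obtain ⟨p, hp0, hp, -⟩ := exists_tendsto_clearingIter ha hℓ
  exact Classical.epsilon_spec
    (p := fun p => (∀ i, 0 ≤ p i) ∧ Phi (relPi ℓ) a (lbar ℓ) p = p) ⟨p, hp0, hp⟩

theorem tendsto_clearingIter {N : ℕ} {a : Fin N → ℝ} {ℓ : Fin N → Fin N → ℝ}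
    (ha : ∀ i, 0 < a i) (hℓ : ∀ i j, 0 ≤ ℓ i j) :
    Filter.Tendsto (clearingIter a ℓ) Filter.atTop (nhds (clearingVec a ℓ)) := by
  obtain ⟨p, hp0, hp, hlim⟩ := exists_tendsto_clearingIter ha hℓ
  obtain ⟨hc0, hc⟩ := clearingVec_spec ha hℓ
  rwa [(Phi_fixedPoint_le (relPi_nonneg hℓ) ha hc0 hp0 hc hp).antisymm
    (Phi_fixedPoint_le (relPi_nonneg hℓ) ha hp0 hc0 hp hc)]

theorem clearingVec_le_lbar {N : ℕ} {a : Fin N → ℝ} {ℓ : Fin N → Fin N → ℝ}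
    (ha : ∀ i, 0 < a i) (hℓ : ∀ i j, 0 ≤ ℓ i j) (i : Fin N) : clearingVec a ℓ i ≤ lbar ℓ i := by
  rw [← (clearingVec_spec ha hℓ).2]
  exact min_le_right _ _

theorem aggLoss_nonneg {N : ℕ} {a : Fin N → ℝ} {ℓ : Fin N → Fin N → ℝ}
    (ha : ∀ i, 0 < a i) (hℓ : ∀ i j, 0 ≤ ℓ i j) : 0 ≤ aggLoss a ℓ :=
  Finset.sum_nonneg fun i _ => sub_nonneg.2 (clearingVec_le_lbar ha hℓ i)

theorem aggLoss_le_sum {N : ℕ} {a : Fin N → ℝ} {ℓ : Fin N → Fin N → ℝ}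
    (ha : ∀ i, 0 < a i) (hℓ : ∀ i j, 0 ≤ ℓ i j) : aggLoss a ℓ ≤ ∑ i, ∑ j, ℓ i j :=
  Finset.sum_le_sum fun i _ => sub_le_self _ ((clearingVec_spec ha hℓ).1 i)

/-- If the assets of every node cover its total liabilities, there is no loss. -/
theorem aggLoss_eq_zero {N : ℕ} {a : Fin N → ℝ} {ℓ : Fin N → Fin N → ℝ}
    (ha : ∀ i, 0 < a i) (hℓ : ∀ i j, 0 ≤ ℓ i j) (hle : ∀ i, lbar ℓ i ≤ a i) :
    aggLoss a ℓ = 0 := by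
  obtain ⟨hc0, hc⟩ := clearingVec_spec ha hℓ
  refine Finset.sum_eq_zero fun i _ => sub_eq_zero.2 (le_antisymm ?_ (clearingVec_le_lbar ha hℓ i))
  rw [← hc]
  exact le_min ((hle i).trans (le_add_of_nonneg_left
    (Finset.sum_nonneg fun j _ => mul_nonneg (relPi_nonneg hℓ j i) (hc0 j)))) le_rfl

theorem measurable_lbar {N : ℕ} : Measurable (lbar : (Fin N → Fin N → ℝ) → Fin N → ℝ) := by
  unfold lbar
  fun_prop

theorem measurable_relPi {N : ℕ} :
    Measurable (relPi : (Fin N → Fin N → ℝ) → Fin N → Fin N → ℝ) := by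
  have hl (i : Fin N) : Measurable fun ℓ : Fin N → Fin N → ℝ => lbar ℓ i :=
    (measurable_pi_apply i).comp measurable_lbar
  refine measurable_pi_lambda _ fun i => measurable_pi_lambda _ fun j => ?_
  exact Measurable.ite (measurableSet_lt measurable_const (hl i))
    (Measurable.div (by fun_prop) (hl i)) measurable_const

theorem measurable_clearingIter {Ω : Type*} [MeasurableSpace Ω] {N : ℕ} {A : Ω → Fin N → ℝ}
    {L : Ω → Fin N → Fin N → ℝ} (hA : Measurable A) (hL : Measurable L) (n : ℕ) :
    Measurable fun ω => clearingIter (A ω) (L ω) n := by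
  have hlb := measurable_lbar.comp hL
  have hπ := measurable_relPi.comp hL
  induction n with
  | zero => exact hlb
  | succ n ih =>
    refine measurable_pi_lambda _ fun i => Measurable.min ?_ ((measurable_pi_apply i).comp hlb)
    refine Measurable.add (Finset.measurable_fun_sum _ fun j _ => Measurable.mul ?_ ?_) ?_
    · exact (measurable_pi_apply i).comp ((measurable_pi_apply j).comp hπ)
    · exact (measurable_pi_apply j).comp ih
    · exact (measurable_pi_apply i).comp hA

theorem measurable_aggLoss {Ω : Type*} [MeasurableSpace Ω] {N : ℕ} {A : Ω → Fin N → ℝ}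
    {L : Ω → Fin N → Fin N → ℝ} (hA : Measurable A) (hL : Measurable L)
    (hApos : ∀ ω i, 0 < A ω i) (hLnn : ∀ ω i j, 0 ≤ L ω i j) :
    Measurable fun ω => aggLoss (A ω) (L ω) := by
  have hlb := measurable_lbar.comp hL
  have hc : Measurable fun ω => clearingVec (A ω) (L ω) :=
    measurable_of_tendsto_metrizable (measurable_clearingIter hA hL)
      (tendsto_pi_nhds.2 fun ω => tendsto_clearingIter (hApos ω) (hLnn ω))
  exact Finset.measurable_fun_sum _ fun i _ =>
    ((measurable_pi_apply i).comp hlb).sub ((measurable_pi_apply i).comp hc)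

theorem integrable_aggLoss {Ω : Type*} [MeasurableSpace Ω] {P : Measure Ω} {N : ℕ}
    {A : Ω → Fin N → ℝ} {L : Ω → Fin N → Fin N → ℝ} (hA : Measurable A) (hL : Measurable L)
    (hApos : ∀ ω i, 0 < A ω i) (hLnn : ∀ ω i j, 0 ≤ L ω i j)
    (hLint : Integrable (fun ω => ∑ i, ∑ j, L ω i j) P) :
    Integrable (fun ω => aggLoss (A ω) (L ω)) P :=
  hLint.mono' (measurable_aggLoss hA hL hApos hLnn).aestronglyMeasurable
    (.of_forall fun ω => by
      rw [Real.norm_of_nonneg (aggLoss_nonneg (hApos ω) (hLnn ω))]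
      exact aggLoss_le_sum (hApos ω) (hLnn ω))

/-- The expected loss vanishes as the constant capital injected at every node grows. -/
theorem tendsto_integral_aggLoss_add_const {Ω : Type*} [MeasurableSpace Ω] {P : Measure Ω}
    {N : ℕ} {A : Ω → Fin N → ℝ} {L : Ω → Fin N → Fin N → ℝ} (hA : Measurable A)
    (hL : Measurable L) (hApos : ∀ ω i, 0 < A ω i) (hLnn : ∀ ω i j, 0 ≤ L ω i j)
    (hLint : Integrable (fun ω => ∑ i, ∑ j, L ω i j) P) :
    Filter.Tendsto (fun n : ℕ => ∫ ω, aggLoss (fun i => A ω i + n) (L ω) ∂P)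
      Filter.atTop (nhds 0) := by
  have hpos (n : ℕ) (ω : Ω) (i : Fin N) : 0 < A ω i + n := by
    have := hApos ω i
    positivity
  rw [← integral_zero Ω ℝ (μ := P)]
  refine tendsto_integral_of_dominated_convergence _ (fun n => ?_) hLint (fun n => ?_) ?_
  · exact (measurable_aggLoss (A := fun ω i => A ω i + n) (by fun_prop) hL (hpos n)
      hLnn).aestronglyMeasurable
  · refine .of_forall fun ω => ?_
    rw [Real.norm_of_nonneg (aggLoss_nonneg (hpos n ω) (hLnn ω))]
    exact aggLoss_le_sum (hpos n ω) (hLnn ω)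
  · refine .of_forall fun ω => tendsto_const_nhds.congr' ?_
    obtain ⟨m, hm⟩ := exists_nat_ge (∑ i, lbar (L ω) i)
    filter_upwards [Filter.eventually_ge_atTop m] with n hn
    refine (aggLoss_eq_zero (hpos n ω) (hLnn ω) fun i => ?_).symm
    have h1 : lbar (L ω) i ≤ ∑ i, lbar (L ω) i :=
      Finset.single_le_sum (fun j _ => lbar_nonneg (hLnn ω) j) (Finset.mem_univ i)
    have h2 : (m : ℝ) ≤ n := by exact_mod_cast hn
    linarith [hApos ω i]

theorem nonneg_of_mem_feas {Ω : Type*} [MeasurableSpace Ω] {P : Measure Ω}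
    [IsProbabilityMeasure P] {N : ℕ} {η : (Ω → ℝ) → ℝ} {A : Ω → Fin N → ℝ}
    {L : Ω → Fin N → Fin N → ℝ} {b c : ℝ} (hc : c ∈ feas P η A L b) : 0 ≤ c := by
  obtain ⟨Y, -, hY0, hYc, -⟩ := hc
  obtain ⟨ω, hω⟩ := hYc.exists
  exact hω ▸ Finset.sum_nonneg fun i _ => hY0 ω i

/-- For a random financial network `(A, L)` with integrable liability matrix
and `b > 0`, the systemic risk measure satisfies `0 ≤ ρ_b(A, L) < +∞`; in particular a
constant allocation `y` makes the system acceptable and bounds `ρ_b(A, L)` from above. -/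
theorem sysRisk_well_defined
    {Ω : Type*} [MeasurableSpace Ω] (P : Measure Ω) [IsProbabilityMeasure P]
    (N : ℕ) (hN : 1 ≤ N)
    (η : (Ω → ℝ) → ℝ)
    (hη_mono : ∀ X Y : Ω → ℝ, Integrable X P → Integrable Y P →
      (∀ᵐ ω ∂P, X ω ≤ Y ω) → η X ≤ η Y)
    (hη_conv : ∀ X Y : Ω → ℝ, Integrable X P → Integrable Y P → ∀ t : ℝ, 0 ≤ t → t ≤ 1 →
      η (fun ω => t * X ω + (1 - t) * Y ω) ≤ t * η X + (1 - t) * η Y)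
    (hη_norm : η (fun _ => 0) = 0)
    (hη_cont : ∀ ε : ℝ, 0 < ε → ∃ δ : ℝ, 0 < δ ∧ ∀ X Y : Ω → ℝ,
      Integrable X P → Integrable Y P → (∫ ω, |X ω - Y ω| ∂P) < δ → |η X - η Y| < ε)
    (A : Ω → Fin N → ℝ) (hA : Measurable A) (hApos : ∀ ω i, 0 < A ω i)
    (L : Ω → Fin N → Fin N → ℝ) (hL : Measurable L)
    (hLnn : ∀ ω i j, 0 ≤ L ω i j) (hLdiag : ∀ ω i, L ω i i = 0)
    (hLint : Integrable (fun ω => ∑ i, ∑ j, L ω i j) P)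
    (b : ℝ) (hb : 0 < b)
    :
    0 ≤ sysRisk P η A L b ∧
    ∃ y : Fin N → ℝ, (∀ i, 0 ≤ y i) ∧
      η (fun ω => aggLoss (fun i => A ω i + y i) (L ω)) ≤ b ∧
      sysRisk P η A L b ≤ ∑ i, y i := by
  refine ⟨Real.sInf_nonneg fun c hc => nonneg_of_mem_feas hc, ?_⟩
  obtain ⟨δ, hδ, hclose⟩ := hη_cont b hb
  obtain ⟨n, hn⟩ := ((tendsto_integral_aggLoss_add_const hA hL hApos hLnn
    hLint).eventually_lt_const hδ).exists
  have hpos (ω : Ω) (i : Fin N) : 0 < A ω i + n := by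
    have := hApos ω i
    positivity
  have hacc : η (fun ω => aggLoss (fun i => A ω i + n) (L ω)) ≤ b := by
    have h := hclose _ (fun _ => 0)
      (integrable_aggLoss (A := fun ω i => A ω i + n) (by fun_prop) hL hpos hLnn hLint)
      (integrable_zero _ _ _)
      (by simpa only [sub_zero, abs_of_nonneg (aggLoss_nonneg (hpos _) (hLnn _))] using hn)
    rw [hη_norm, sub_zero] at h
    exact (le_abs_self _).trans h.le
  refine ⟨fun _ => n, fun _ => n.cast_nonneg, hacc,
    csInf_le ⟨0, fun c hc => nonneg_of_mem_feas hc⟩ ?_⟩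
  exact ⟨fun _ _ => n, measurable_const, fun _ _ => n.cast_nonneg, .of_forall fun _ => rfl, hacc⟩
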